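/- Let a, b be negative rational numbers and let D = ℍ[ℚ, a, b] be the corresponding definite quaternion algebra over ℚ. Let O be a subring of D that is closed under quaternion conjugation and finitely generated as a ℤ-module. Then the set O¹ = { x ∈ O : x · (star x) = 1 } of reduced-norm-one elements of O is finite and has cardinality at most 24. -/

import Mathlib

open Quaternion

/-- If a finite group has a central element `z ≠ 1` such that the centralizers of all elements
other than `1` and `z` have order dividing `n`, then the order of the group divides `2 * n`. -/
theorem Group.card_dvd_two_mul_of_card_centralizer_dvd {G : Type*} [Group G] [Finite G] {z : G}
    (hz : z ∈ Subgroup.center G) (hz1 : z ≠ 1) {n : ℕ}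
    (h : ∀ x : G, x ≠ 1 → x ≠ z → Nat.card (Subgroup.centralizer {x}) ∣ n) :
    Nat.card G ∣ 2 * n := by
  classical
  cases nonempty_fintype G
  have hcentral : ∀ w ∈ Subgroup.center G, (ConjClasses.mk w).carrier = {w} := by
    intro w hw
    ext y
    rw [ConjClasses.mem_carrier_iff_mk_eq, ConjClasses.mk_eq_mk_iff_isConj,
      Set.mem_singleton_iff]
    constructor
    · intro hy
      obtain ⟨c, hc⟩ := isConj_iff.1 hy.symm
      rw [Subgroup.mem_center_iff] at hw
      rw [← hc, hw c, mul_inv_cancel_right]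
    · rintro rfl
      exact IsConj.refl _
  have hne : ConjClasses.mk z ≠ ConjClasses.mk (1 : G) := by
    intro e
    have e' := hcentral z hz
    rw [e, hcentral 1 (Subgroup.one_mem _)] at e'
    exact hz1 (Set.singleton_injective e').symm
  have hdvd : ∀ c : ConjClasses G, c ≠ ConjClasses.mk 1 → c ≠ ConjClasses.mk z →
      Nat.card G ∣ n * c.carrier.ncard := by
    rintro ⟨x⟩ hx1 hxz
    have hx := h x (fun e => hx1 (by rw [e]; rfl)) (fun e => hxz (by rw [e]; rfl))
    have hcard : Nat.card G
        = Nat.card (Subgroup.centralizer {x}) * (ConjClasses.mk x).carrier.ncard := by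
      rw [Subgroup.nat_card_centralizer_nat_card_stabilizer, ← Nat.card_coe_set_eq,
        ← ConjAct.orbit_eq_carrier_conjClasses, mul_comm, ← Nat.card_prod,
        Nat.card_congr (MulAction.orbitProdStabilizerEquivGroup (ConjAct G) x)]
      rfl
    rw [hcard]
    exact Nat.mul_dvd_mul_right hx _
  have hsum := Group.sum_card_conj_classes_eq_card G
  rw [finsum_eq_sum_of_fintype,
    ← Finset.add_sum_erase _ _ (Finset.mem_univ (ConjClasses.mk (1 : G))),
    ← Finset.add_sum_erase _ _
      (Finset.mem_erase.2 ⟨hne, Finset.mem_univ (ConjClasses.mk z)⟩),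
    hcentral z hz, hcentral 1 (Subgroup.one_mem _), Set.ncard_singleton,
    Set.ncard_singleton] at hsum
  have hrest : Nat.card G ∣ n * ∑ c ∈ (Finset.univ.erase (ConjClasses.mk (1 : G))).erase
      (ConjClasses.mk z), c.carrier.ncard := by
    rw [Finset.mul_sum]
    refine Finset.dvd_sum fun c hc => ?_
    simp only [Finset.mem_erase] at hc
    exact hdvd c hc.2.1 hc.1
  refine (Nat.dvd_add_left hrest).1 ?_
  refine ⟨n, ?_⟩
  nth_rewrite 1 [← hsum]
  ring

/-- A bounded set of values of an additive map from a finitely generated group to `ℚ` is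
finite. -/
theorem AddMonoidHom.finite_range_inter_abs_le {A : Type*} [AddGroup A] [AddGroup.FG A]
    (f : A →+ ℚ) (C : ℚ) : {q : ℚ | q ∈ Set.range f ∧ |q| ≤ C}.Finite := by
  obtain ⟨S, hS⟩ := AddGroup.fg_def.1 ‹AddGroup.FG A›
  obtain ⟨m, hm⟩ := IsLocalization.exist_integer_multiples (nonZeroDivisors ℤ) S f
  have hm0 : ((m : ℤ) : ℚ) ≠ 0 := by exact_mod_cast nonZeroDivisors.ne_zero m.2
  have hint : ∀ x : A, ∃ k : ℤ, (k : ℚ) = (m : ℤ) * f x := by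
    intro x
    have hx : x ∈ AddSubgroup.closure (S : Set A) := hS ▸ AddSubgroup.mem_top x
    induction hx using AddSubgroup.closure_induction with
    | mem x hx =>
      obtain ⟨k, hk⟩ := hm x hx
      exact ⟨k, by simpa using hk⟩
    | zero => exact ⟨0, by simp⟩
    | add x y _ _ hx hy =>
      obtain ⟨k, hk⟩ := hx
      obtain ⟨l, hl⟩ := hy
      exact ⟨k + l, by push_cast; rw [hk, hl, map_add]; ring⟩
    | neg x _ hx =>
      obtain ⟨k, hk⟩ := hx
      exact ⟨-k, by push_cast; rw [hk, map_neg]; ring⟩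
  set K : ℤ := ⌈|((m : ℤ) : ℚ)| * C⌉
  refine ((Set.finite_Icc (-K) K).image fun k : ℤ => (k : ℚ) / (m : ℤ)).subset ?_
  rintro _ ⟨⟨x, rfl⟩, hx⟩
  obtain ⟨k, hk⟩ := hint x
  refine ⟨k, ?_, ?_⟩
  · have hkK : |(k : ℚ)| ≤ K := by
      rw [hk, abs_mul]
      exact (mul_le_mul_of_nonneg_left hx (abs_nonneg _)).trans (Int.le_ceil _)
    rw [Set.mem_Icc, ← abs_le]
    exact_mod_cast hkK
  · simp only [hk]
    field_simp

namespace QuaternionAlgebra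

theorem mul_star_eq_one_iff {a b : ℚ} {x : ℍ[ℚ, a, b]} :
    x * star x = 1 ↔
      x.re ^ 2 - a * x.imI ^ 2 - b * x.imJ ^ 2 + a * b * x.imK ^ 2 = 1 := by
  have h : (x * star x).re
      = x.re ^ 2 - a * x.imI ^ 2 - b * x.imJ ^ 2 + a * b * x.imK ^ 2 := by
    simp
    ring
  rw [mul_star_eq_coe, h]
  exact coe_inj (y := 1)

theorem star_mul_self_eq_one {a b : ℚ} {x : ℍ[ℚ, a, b]} (h : x * star x = 1) :
    star x * x = 1 := by
  rwa [star_comm_self']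

variable {a b : ℚ} {O : Subring ℍ[ℚ, a, b]}

theorem finite_norm_one (ha : a < 0) (hb : b < 0) [AddGroup.FG O] :
    {x : ℍ[ℚ, a, b] | x ∈ O ∧ x * star x = 1}.Finite := by
  let F : (ℍ[ℚ, a, b] →+ ℚ) → O →+ ℚ := fun φ => φ.comp O.subtype.toAddMonoidHom
  let f₀ := F ⟨⟨fun x => x.re, rfl⟩, fun _ _ => rfl⟩
  let f₁ := F ⟨⟨fun x => x.imI, rfl⟩, fun _ _ => rfl⟩
  let f₂ := F ⟨⟨fun x => x.imJ, rfl⟩, fun _ _ => rfl⟩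
  let f₃ := F ⟨⟨fun x => x.imK, rfl⟩, fun _ _ => rfl⟩
  have hab := mul_pos_of_neg_of_neg ha hb
  have key : ∀ c q : ℚ, 0 < c → c * q ^ 2 ≤ 1 → |q| ≤ 1 + 1 / c := by
    intro c q hc h
    have h1 : q ^ 2 ≤ 1 / c := by rw [le_div_iff₀ hc]; linarith
    nlinarith [sq_abs q, sq_nonneg (|q| - 1)]
  refine Set.Finite.subset (Set.Finite.preimage (equivProd a 0 b).injective.injOn
    ((f₀.finite_range_inter_abs_le (1 + 1 / 1)).prod
      ((f₁.finite_range_inter_abs_le (1 + 1 / (-a))).prod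
        ((f₂.finite_range_inter_abs_le (1 + 1 / (-b))).prod
          (f₃.finite_range_inter_abs_le (1 + 1 / (a * b))))))) ?_
  rintro x ⟨hxO, hx⟩
  rw [mul_star_eq_one_iff] at hx
  have h0 := sq_nonneg x.re
  have h1 := mul_nonneg (neg_pos.2 ha).le (sq_nonneg x.imI)
  have h2 := mul_nonneg (neg_pos.2 hb).le (sq_nonneg x.imJ)
  have h3 := mul_nonneg hab.le (sq_nonneg x.imK)
  refine ⟨⟨⟨⟨x, hxO⟩, rfl⟩, key _ _ one_pos ?_⟩, ⟨⟨⟨x, hxO⟩, rfl⟩, key _ _ (neg_pos.2 ha) ?_⟩,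
    ⟨⟨⟨x, hxO⟩, rfl⟩, key _ _ (neg_pos.2 hb) ?_⟩, ⟨⟨⟨x, hxO⟩, rfl⟩, key _ _ hab ?_⟩⟩ <;>
  · simp only [equivProd_apply]
    linarith

theorem exists_int_eq_two_mul_re (hstar : ∀ x ∈ O, star x ∈ O) [AddGroup.FG O]
    {x : ℍ[ℚ, a, b]} (hx : x ∈ O) : ∃ n : ℤ, (n : ℚ) = 2 * x.re := by
  have : Module.Finite ℤ O := Module.Finite.iff_addGroup_fg.2 ‹_›
  have hmem : algebraMap ℚ ℍ[ℚ, a, b] (2 * x.re) ∈ O := by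
    have h := O.add_mem hx (hstar x hx)
    rw [self_add_star'] at h
    simpa using! h
  have hint : IsIntegral ℤ (algebraMap ℚ ℍ[ℚ, a, b] (2 * x.re)) :=
    (IsIntegral.of_finite ℤ (⟨_, hmem⟩ : O)).map O.subtype.toIntAlgHom
  rw [isIntegral_algebraMap_iff (FaithfulSMul.algebraMap_injective ℚ ℍ[ℚ, a, b])] at hint
  exact IsIntegrallyClosed.isIntegral_iff.1 hint

theorem im_eq_zero_of_re_sq_eq_one (ha : a < 0) (hb : b < 0) {x : ℍ[ℚ, a, b]}
    (hx : x * star x = 1) (hre : x.re ^ 2 = 1) : x.imI = 0 ∧ x.imJ = 0 ∧ x.imK = 0 := by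
  rw [mul_star_eq_one_iff] at hx
  have hab := mul_pos_of_neg_of_neg ha hb
  have h1 := mul_nonneg (neg_pos.2 ha).le (sq_nonneg x.imI)
  have h2 := mul_nonneg (neg_pos.2 hb).le (sq_nonneg x.imJ)
  have h3 := mul_nonneg hab.le (sq_nonneg x.imK)
  refine ⟨?_, ?_, ?_⟩
  · have : a * x.imI ^ 2 = 0 := by linarith
    simpa [ha.ne] using this
  · have : b * x.imJ ^ 2 = 0 := by linarith
    simpa [hb.ne] using this
  · have : a * b * x.imK ^ 2 = 0 := by linarith
    simpa [ha.ne, hb.ne] using this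

theorem re_cases (ha : a < 0) (hb : b < 0) {x : ℍ[ℚ, a, b]} (hx : x * star x = 1)
    (hint : ∃ n : ℤ, (n : ℚ) = 2 * x.re) :
    x = 1 ∨ x = -1 ∨ x.re = 0 ∨ x.re = 1 / 2 ∨ x.re = -1 / 2 := by
  obtain ⟨n, hn⟩ := hint
  have hn4 : (n : ℚ) ^ 2 ≤ 4 := by
    have hx' := mul_star_eq_one_iff.1 hx
    have h1 := mul_nonneg (neg_pos.2 ha).le (sq_nonneg x.imI)
    have h2 := mul_nonneg (neg_pos.2 hb).le (sq_nonneg x.imJ)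
    have h3 := mul_nonneg (mul_pos_of_neg_of_neg ha hb).le (sq_nonneg x.imK)
    rw [hn]
    linarith
  have hn4' : n ^ 2 ≤ 4 := by exact_mod_cast hn4
  have hlo : -2 ≤ n := by nlinarith
  have hhi : n ≤ 2 := by nlinarith
  have hre : x.re = n / 2 := by rw [hn]; ring
  interval_cases n
  · norm_num at hre
    obtain ⟨h1, h2, h3⟩ := im_eq_zero_of_re_sq_eq_one ha hb hx (by rw [hre]; norm_num)
    exact Or.inr (Or.inl (by ext <;> simp [hre, h1, h2, h3]))
  · norm_num at hre ⊢
    simp [hre]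
  · norm_num at hre
    simp [hre]
  · norm_num at hre ⊢
    simp [hre]
  · norm_num at hre
    obtain ⟨h1, h2, h3⟩ := im_eq_zero_of_re_sq_eq_one ha hb hx (by rw [hre]; norm_num)
    exact Or.inl (by ext <;> simp [hre, h1, h2, h3])

/-- The centralizer of a non-scalar quaternion `x` is `ℚ[x]`. -/
theorem exists_im_eq_of_commute (ha : a < 0) (hb : b < 0) {x g : ℍ[ℚ, a, b]}
    (hx : ¬(x.imI = 0 ∧ x.imJ = 0 ∧ x.imK = 0)) (hg : Commute g x) :
    ∃ f : ℚ, g.imI = f * x.imI ∧ g.imJ = f * x.imJ ∧ g.imK = f * x.imK := by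
  have e := hg.eq
  have e1 := congrArg imI e
  have e2 := congrArg imJ e
  have e3 := congrArg imK e
  simp only [imI_mul, imJ_mul, imK_mul] at e1 e2 e3
  have c1 : g.imJ * x.imK = g.imK * x.imJ := mul_left_cancel₀ hb.ne (by linarith)
  have c2 : g.imI * x.imK = g.imK * x.imI := mul_left_cancel₀ ha.ne (by linarith)
  have c3 : g.imI * x.imJ = g.imJ * x.imI := by linarith
  by_cases h1 : x.imI = 0
  · by_cases h2 : x.imJ = 0
    · have h3 : x.imK ≠ 0 := fun h3 => hx ⟨h1, h2, h3⟩
      refine ⟨g.imK / x.imK, ?_, ?_, ?_⟩ <;> field_simp <;> linarith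
    · refine ⟨g.imJ / x.imJ, ?_, ?_, ?_⟩ <;> field_simp <;> linarith
  · refine ⟨g.imI / x.imI, ?_, ?_, ?_⟩ <;> field_simp <;> linarith

theorem sq_eq_of_mul_star_eq_one {x : ℍ[ℚ, a, b]} (hx : x * star x = 1) :
    x ^ 2 = (2 * x.re) • x - 1 := by
  rw [mul_star_eq_one_iff] at hx
  rw [sq]
  ext <;> simp <;> linarith

theorem cube_eq_neg_one_of_re_eq_half {y : ℍ[ℚ, a, b]} (hy : y * star y = 1)
    (hre : y.re = 1 / 2) : y ^ 3 = -1 := by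
  have hy2 : y ^ 2 = y - 1 := by simpa [hre] using sq_eq_of_mul_star_eq_one hy
  rw [pow_succ, hy2, sub_mul, ← sq, hy2]
  noncomm_ring

/-- An element of norm one with integral trace commuting with a norm one element `y` of
order `4` is a power of `y`. -/
theorem exists_pow_of_commute_of_re_eq_zero (ha : a < 0) (hb : b < 0) {y g : ℍ[ℚ, a, b]}
    (hy : y * star y = 1) (hre : y.re = 0) (hg : g * star g = 1)
    (hint : ∃ n : ℤ, (n : ℚ) = 2 * g.re) (hc : Commute g y) : ∃ n : ℕ, g = y ^ n := by
  have hy2 : y ^ 2 = -1 := by simpa [hre] using sq_eq_of_mul_star_eq_one hy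
  rw [mul_star_eq_one_iff] at hy
  obtain ⟨f, f1, f2, f3⟩ := exists_im_eq_of_commute ha hb
    (by rintro ⟨h1, h2, h3⟩; norm_num [hre, h1, h2, h3] at hy) hc
  have hnorm : g.re ^ 2 + f ^ 2 = 1 := by
    have hg' := mul_star_eq_one_iff.1 hg
    rw [f1, f2, f3] at hg'
    rw [hre] at hy
    linear_combination hg' - f ^ 2 * hy
  have hirr : ¬ f ^ 2 = 3 / 4 := by
    intro h
    have : IsSquare (3 : ℚ) := ⟨2 * f, by linarith⟩
    norm_num at this
  rcases re_cases ha hb hg hint with h | h | h | h | h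
  · exact ⟨0, by simp [h]⟩
  · exact ⟨2, by rw [h, hy2]⟩
  · rw [h] at hnorm
    rcases sq_eq_one_iff.1 (by linarith : f ^ 2 = 1) with hf | hf
    · exact ⟨1, by ext <;> simp [h, hre, f1, f2, f3, hf]⟩
    · refine ⟨3, ?_⟩
      rw [pow_succ, hy2]
      ext <;> simp [h, hre, f1, f2, f3, hf]
  · exact absurd (by rw [h] at hnorm; linarith) hirr
  · exact absurd (by rw [h] at hnorm; linarith) hirr

/-- An element of norm one with integral trace commuting with a norm one element `y` of
order `6` is a power of `y`. -/
theorem exists_pow_of_commute_of_re_eq_half (ha : a < 0) (hb : b < 0) {y g : ℍ[ℚ, a, b]}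
    (hy : y * star y = 1) (hre : y.re = 1 / 2) (hg : g * star g = 1)
    (hint : ∃ n : ℤ, (n : ℚ) = 2 * g.re) (hc : Commute g y) : ∃ n : ℕ, g = y ^ n := by
  have hy2 : y ^ 2 = y - 1 := by simpa [hre] using sq_eq_of_mul_star_eq_one hy
  have hy3 := cube_eq_neg_one_of_re_eq_half hy hre
  rw [mul_star_eq_one_iff] at hy
  obtain ⟨f, f1, f2, f3⟩ := exists_im_eq_of_commute ha hb
    (by rintro ⟨h1, h2, h3⟩; norm_num [hre, h1, h2, h3] at hy) hc
  have hnorm : g.re ^ 2 + 3 / 4 * f ^ 2 = 1 := by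
    have hg' := mul_star_eq_one_iff.1 hg
    rw [f1, f2, f3] at hg'
    rw [hre] at hy
    linear_combination hg' - f ^ 2 * hy
  have hy4 : y ^ 4 = -y := by rw [pow_succ, hy3, neg_one_mul]
  have hy5 : y ^ 5 = 1 - y := by rw [pow_succ, hy4, neg_mul, ← sq, hy2, neg_sub]
  rcases re_cases ha hb hg hint with h | h | h | h | h
  · exact ⟨0, by simp [h]⟩
  · exact ⟨3, by rw [h, hy3]⟩
  · rw [h] at hnorm
    have : IsSquare (3 : ℚ) := ⟨3 / 2 * f, by linarith⟩
    norm_num at this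
  · rw [h] at hnorm
    rcases sq_eq_one_iff.1 (by linarith : f ^ 2 = 1) with hf | hf
    · exact ⟨1, by ext <;> simp [h, hre, f1, f2, f3, hf]⟩
    · refine ⟨5, ?_⟩
      rw [hy5]
      ext <;> norm_num [h, hre, f1, f2, f3, hf]
  · rw [h] at hnorm
    rcases sq_eq_one_iff.1 (by linarith : f ^ 2 = 1) with hf | hf
    · refine ⟨2, ?_⟩
      rw [hy2]
      ext <;> norm_num [h, hre, f1, f2, f3, hf]
    · refine ⟨4, ?_⟩
      rw [hy4]
      ext <;> norm_num [h, hre, f1, f2, f3, hf]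

/-- Every element of norm one with integral trace commuting with `x ≠ ±1` is a power of a
fixed `y ∈ {x, -x}` satisfying `y ^ 12 = 1`. -/
theorem exists_generator_of_commute (ha : a < 0) (hb : b < 0) {x : ℍ[ℚ, a, b]}
    (hx : x * star x = 1) (hint : ∃ n : ℤ, (n : ℚ) = 2 * x.re) (h1 : x ≠ 1) (h2 : x ≠ -1) :
    ∃ y : ℍ[ℚ, a, b], (y = x ∨ y = -x) ∧ y ^ 12 = 1 ∧
      ∀ g : ℍ[ℚ, a, b], g * star g = 1 → (∃ n : ℤ, (n : ℚ) = 2 * g.re) → Commute g x →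
        ∃ n : ℕ, g = y ^ n := by
  have hhalf : ∀ y : ℍ[ℚ, a, b], y * star y = 1 → y.re = 1 / 2 → y ^ 12 = 1 := by
    intro y hy hre
    rw [show 12 = 3 * 4 from rfl, pow_mul, cube_eq_neg_one_of_re_eq_half hy hre]
    norm_num
  rcases re_cases ha hb hx hint with h | h | h | h | h
  · exact absurd h h1
  · exact absurd h h2
  · refine ⟨x, Or.inl rfl, ?_, fun g hg hgi hc =>
      exists_pow_of_commute_of_re_eq_zero ha hb hx h hg hgi hc⟩
    have hx2 : x ^ 2 = -1 := by simpa [h] using sq_eq_of_mul_star_eq_one hx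
    rw [show 12 = 2 * 6 from rfl, pow_mul, hx2]
    norm_num
  · exact ⟨x, Or.inl rfl, hhalf x hx h, fun g hg hgi hc =>
      exists_pow_of_commute_of_re_eq_half ha hb hx h hg hgi hc⟩
  · have hx' : -x * star (-x) = 1 := by rw [star_neg, neg_mul_neg, hx]
    have h' : (-x).re = 1 / 2 := by rw [re_neg, h]; norm_num
    exact ⟨-x, Or.inr rfl, hhalf _ hx' h', fun g hg hgi hc =>
      exists_pow_of_commute_of_re_eq_half ha hb hx' h' hg hgi hc.neg_right⟩

/-- The group of norm one elements of a subring closed under conjugation. -/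
def normOneSubgroup (O : Subring ℍ[ℚ, a, b]) (hstar : ∀ x ∈ O, star x ∈ O) :
    Subgroup ℍ[ℚ, a, b]ˣ where
  carrier := {u | (u : ℍ[ℚ, a, b]) ∈ O ∧ (u : ℍ[ℚ, a, b]) * star (u : ℍ[ℚ, a, b]) = 1}
  one_mem' := ⟨O.one_mem, by simp⟩
  mul_mem' := by
    rintro u v ⟨hu, hu'⟩ ⟨hv, hv'⟩
    refine ⟨O.mul_mem hu hv, ?_⟩
    rw [Units.val_mul, star_mul, mul_assoc, ← mul_assoc (v : ℍ[ℚ, a, b]), hv', one_mul, hu']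
  inv_mem' := by
    rintro u ⟨hu, hu'⟩
    have hinv : ((u⁻¹ : ℍ[ℚ, a, b]ˣ) : ℍ[ℚ, a, b]) = star (u : ℍ[ℚ, a, b]) :=
      Units.inv_eq_of_mul_eq_one_right hu'
    refine ⟨?_, ?_⟩
    · rw [hinv]
      exact hstar _ hu
    · rw [hinv, star_star]
      exact star_mul_self_eq_one hu'

theorem image_normOneSubgroup (hstar : ∀ x ∈ O, star x ∈ O) :
    Units.val '' (normOneSubgroup O hstar : Set ℍ[ℚ, a, b]ˣ)
      = {x : ℍ[ℚ, a, b] | x ∈ O ∧ x * star x = 1} := by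
  ext x
  constructor
  · rintro ⟨u, hu, rfl⟩
    exact hu
  · intro hx
    exact ⟨⟨x, star x, hx.2, star_mul_self_eq_one hx.2⟩, hx, rfl⟩

theorem card_normOneSubgroup_dvd (ha : a < 0) (hb : b < 0) (hstar : ∀ x ∈ O, star x ∈ O)
    [AddGroup.FG O] [Finite (normOneSubgroup O hstar)] :
    Nat.card (normOneSubgroup O hstar) ∣ 24 := by
  let z : normOneSubgroup O hstar := ⟨-1, by simp, by simp⟩
  have hzval : ((z : ℍ[ℚ, a, b]ˣ) : ℍ[ℚ, a, b]) = -1 := by simp [z]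
  have hinj : Function.Injective
      fun g : normOneSubgroup O hstar => ((g : ℍ[ℚ, a, b]ˣ) : ℍ[ℚ, a, b]) :=
    fun g h e => Subtype.ext (Units.ext e)
  have hzc : z ∈ Subgroup.center (normOneSubgroup O hstar) := by
    refine Subgroup.mem_center_iff.2 fun g => hinj ?_
    simp [hzval]
  have hz1 : z ≠ 1 := by
    intro e
    have e' := congrArg (fun g : normOneSubgroup O hstar =>
      ((g : ℍ[ℚ, a, b]ˣ) : ℍ[ℚ, a, b]).re) e
    simp only [hzval] at e'
    norm_num at e'
  refine Group.card_dvd_two_mul_of_card_centralizer_dvd (n := 12) hzc hz1 fun x hx1 hxz => ?_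
  have hint := fun g : normOneSubgroup O hstar => exists_int_eq_two_mul_re hstar g.2.1
  obtain ⟨y, hy, hy12, hgen⟩ := exists_generator_of_commute ha hb x.2.2 (hint x)
    (fun e => hx1 (hinj (by simpa using e))) (fun e => hxz (hinj (by simpa [hzval] using e)))
  obtain ⟨w, rfl⟩ : ∃ w : normOneSubgroup O hstar, ((w : ℍ[ℚ, a, b]ˣ) : ℍ[ℚ, a, b]) = y := by
    rcases hy with rfl | rfl
    · exact ⟨x, rfl⟩
    · exact ⟨z * x, by simp [hzval]⟩
  have hle : Subgroup.centralizer {x} ≤ Subgroup.zpowers w := by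
    intro g hg
    obtain ⟨n, hn⟩ := hgen _ g.2.2 (hint g) (by
      have := Subgroup.mem_centralizer_singleton_iff.1 hg
      exact congrArg (fun g : normOneSubgroup O hstar => ((g : ℍ[ℚ, a, b]ˣ) : ℍ[ℚ, a, b])) this)
    exact ⟨n, hinj (by simpa using hn.symm)⟩
  refine (Subgroup.card_dvd_of_le hle).trans ?_
  rw [Nat.card_zpowers]
  exact orderOf_dvd_of_pow_eq_one (hinj (by simpa using hy12))

end QuaternionAlgebra

/-- The group of reduced-norm-one elements of a `ℤ`-order of a definite rational quaternion
algebra is finite of order at most `24`.  Here `a, b < 0` are rationals, `D = ℍ[ℚ, a, b]`,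
and `O` is a subring of `D` closed under conjugation and finitely generated as a
`ℤ`-module. -/
theorem quaternion_order_norm_one_le_24 (a b : ℚ) (ha : a < 0) (hb : b < 0)
    (O : Subring ℍ[ℚ, a, b]) (hstar : ∀ x ∈ O, star x ∈ O) (hfg : AddGroup.FG O) :
    {x : ℍ[ℚ, a, b] | x ∈ O ∧ x * star x = 1}.Finite ∧
    {x : ℍ[ℚ, a, b] | x ∈ O ∧ x * star x = 1}.ncard ≤ 24 := by
  have hfin := QuaternionAlgebra.finite_norm_one (O := O) ha hb
  refine ⟨hfin, ?_⟩
  rw [← QuaternionAlgebra.image_normOneSubgroup hstar] at hfin ⊢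
  have hfinite : Finite (QuaternionAlgebra.normOneSubgroup O hstar) :=
    (hfin.of_finite_image Units.val_injective.injOn).to_subtype
  rw [Set.ncard_image_of_injective _ Units.val_injective, ← Nat.card_coe_set_eq]
  exact Nat.le_of_dvd (by norm_num) (QuaternionAlgebra.card_normOneSubgroup_dvd ha hb hstar)
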